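/- In the two-solver configuration, let w satisfy (W) and define the piecewise constant non-increasing constraint p:[0,R]→(0,f(ρ̄)] by p(ξ)=p₁ for ξ∈[0,ρ_L] and p(ξ)=p₂ for ξ∈(ρ_L,R]. Then the explicit profile ρ_p (consisting of a shock of speed λ_p joining ρ_L to ρ̂₂, a stationary nonclassical shock joining ρ̂₂ to ρ̌₂ at x=0, and a shock of speed μ_p joining ρ̌₂ to ρ̄) is an entropy weak solution of the constrained Riemann problem with non-local constraint and datum (ρ_L,ρ_R)=(ρ_L,ρ̄), with constraint level q(t)=p₂ for a.e. t>0; in particular ∫_{ℝ₋} w(x)ρ_p(t,x)dx > ρ_L for every t>0 and f(ρ_p(t,0−))=f(ρ_p(t,0+))=p₂ for a.e. t>0. -/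

import Mathlib

open MeasureTheory Set Filter

namespace CRP

noncomputable section

/-- Smooth compactly supported test functions on `ℝ²`. -/
def TestFn (φ : ℝ × ℝ → ℝ) : Prop :=
  ContDiff ℝ (⊤ : ℕ∞) φ ∧ HasCompactSupport φ

/-- Partial derivative of a test function in the first (time) variable. -/
def pdT (φ : ℝ × ℝ → ℝ) (z : ℝ × ℝ) : ℝ := fderiv ℝ φ z (1, 0)

/-- Partial derivative of a test function in the second (space) variable. -/
def pdX (φ : ℝ × ℝ → ℝ) (z : ℝ × ℝ) : ℝ := fderiv ℝ φ z (0, 1)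

/-- Assumption (F): `f : [0,R] → [0,∞)` is Lipschitz, `f 0 = 0 = f R`, and there is
`ρb ∈ (0,R)` with `f' ρ * (ρb - ρ) > 0` for a.e. `ρ ∈ [0,R]`. -/
def AF (R ρb : ℝ) (f : ℝ → ℝ) : Prop :=
  0 < R ∧ (∃ L : NNReal, LipschitzOnWith L f (Icc 0 R)) ∧
    (∀ x ∈ Icc (0:ℝ) R, 0 ≤ f x) ∧ f 0 = 0 ∧ f R = 0 ∧ ρb ∈ Ioo 0 R ∧
    (∀ᵐ x ∂(volume.restrict (Icc (0:ℝ) R)), deriv f x * (ρb - x) > 0)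

/-- Assumption (W): `w` is a nonnegative non-decreasing weight on `ℝ₋` with unit integral
and support in `[-i_w, 0]`. -/
def AW (w : ℝ → ℝ) : Prop :=
  (∀ x ≤ (0:ℝ), 0 ≤ w x) ∧ MonotoneOn w (Iic 0) ∧
    (∫ x in Iic (0:ℝ), w x) = 1 ∧ ∃ iw : ℝ, 0 < iw ∧ ∀ x ≤ -iw, w x = 0

/-- Assumption (P2): `p : [0,R] → (0, fmax]` is non-increasing and piecewise constant
with finitely many jumps (equivalently, it has finitely many values). -/
def AP2 (R fmax : ℝ) (p : ℝ → ℝ) : Prop :=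
  AntitoneOn p (Icc 0 R) ∧ (∀ ξ ∈ Icc (0:ℝ) R, p ξ ∈ Ioc 0 fmax) ∧ (p '' Icc 0 R).Finite

/-- The left limit `p(ξ−)` of a non-increasing piecewise constant `p` on `[0,R]`,
with the convention `p(0−) = p 0`. -/
def pminus (p : ℝ → ℝ) (ξ : ℝ) : ℝ := if ξ ≤ 0 then p 0 else sInf (p '' Ico 0 ξ)

/-- The right limit `p(ξ+)` of a non-increasing piecewise constant `p` on `[0,R]`,
with the convention `p(R+) = p R`. -/
def pplus (R : ℝ) (p : ℝ → ℝ) (ξ : ℝ) : ℝ := if R ≤ ξ then p R else sSup (p '' Ioc ξ R)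

/-- `γ` is the left measure-theoretic trace of `ρ` at `x = 0`. -/
def LeftTraceAt (ρ : ℝ → ℝ → ℝ) (γ : ℝ → ℝ) : Prop :=
  ∀ φ : ℝ × ℝ → ℝ, TestFn φ →
    Tendsto (fun ε : ℝ => (1 / ε) * ∫ t in Ioi (0:ℝ), ∫ x in Ioo (-ε) (0:ℝ),
        |ρ t x - γ t| * φ (t, x)) (nhdsWithin 0 (Ioi 0)) (nhds 0)

/-- `γ` is the right measure-theoretic trace of `ρ` at `x = 0`. -/
def RightTraceAt (ρ : ℝ → ℝ → ℝ) (γ : ℝ → ℝ) : Prop :=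
  ∀ φ : ℝ × ℝ → ℝ, TestFn φ →
    Tendsto (fun ε : ℝ => (1 / ε) * ∫ t in Ioi (0:ℝ), ∫ x in Ioo (0:ℝ) ε,
        |ρ t x - γ t| * φ (t, x)) (nhdsWithin 0 (Ioi 0)) (nhds 0)

/-- The constrained entropy inequality (i), with constraint level `q`, initial datum `ρ0`,
tested on all nonnegative test functions. -/
def EntIneq (R fmax : ℝ) (f q ρ0 : ℝ → ℝ) (ρ : ℝ → ℝ → ℝ) : Prop :=
  ∀ φ : ℝ × ℝ → ℝ, TestFn φ → (∀ z, 0 ≤ φ z) → ∀ k ∈ Icc (0:ℝ) R,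
    0 ≤ (∫ t in Ioi (0:ℝ), ∫ x : ℝ,
          (|ρ t x - k| * pdT φ (t, x) +
            Real.sign (ρ t x - k) * (f (ρ t x) - f k) * pdX φ (t, x))) +
        2 * (∫ t in Ioi (0:ℝ), (1 - q t / fmax) * f k * φ (t, 0)) +
        ∫ x : ℝ, |ρ0 x - k| * φ (0, x)

/-- The constrained entropy inequality (i) on the time interval `[0,T)`: only test
functions supported in `(-∞,T) × ℝ` are used. -/
def EntIneqOn (R fmax T : ℝ) (f q ρ0 : ℝ → ℝ) (ρ : ℝ → ℝ → ℝ) : Prop :=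
  ∀ φ : ℝ × ℝ → ℝ, TestFn φ → (∀ z, 0 ≤ φ z) →
    tsupport φ ⊆ Iio T ×ˢ (univ : Set ℝ) → ∀ k ∈ Icc (0:ℝ) R,
    0 ≤ (∫ t in Ioi (0:ℝ), ∫ x : ℝ,
          (|ρ t x - k| * pdT φ (t, x) +
            Real.sign (ρ t x - k) * (f (ρ t x) - f k) * pdX φ (t, x))) +
        2 * (∫ t in Ioi (0:ℝ), (1 - q t / fmax) * f k * φ (t, 0)) +
        ∫ x : ℝ, |ρ0 x - k| * φ (0, x)

/-- Basic regularity required of solutions: measurability, values in `[0,R]`, and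
continuity in time with values in `L¹loc` (on compact sets `[-r,r]`). -/
def RegSol (R : ℝ) (ρ : ℝ → ℝ → ℝ) : Prop :=
  Measurable (Function.uncurry ρ) ∧ (∀ t x, ρ t x ∈ Icc (0:ℝ) R) ∧
    ∀ r : ℝ, 0 < r → ∀ s : ℝ, 0 ≤ s →
      Tendsto (fun t => ∫ x in Icc (-r) r, |ρ t x - ρ s x|) (nhdsWithin s (Ici 0)) (nhds 0)

/-- `ρ`, with traces `γm`, `γp` at `x = 0`, satisfies the constrained entropy
inequalities with constraint level `q : (0,∞) → [0,fmax]` and initial datum `ρ0`. -/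
def CEI (R fmax : ℝ) (f q ρ0 : ℝ → ℝ) (ρ : ℝ → ℝ → ℝ) (γm γp : ℝ → ℝ) : Prop :=
  RegSol R ρ ∧ (∀ t, q t ∈ Icc (0:ℝ) fmax) ∧ EntIneq R fmax f q ρ0 ρ ∧
    LeftTraceAt ρ γm ∧ RightTraceAt ρ γp ∧
    (∀ᵐ t ∂(volume.restrict (Ioi (0:ℝ))), f (γm t) ≤ q t ∧ f (γp t) ≤ q t)

/-- Same as `CEI`, but on the time interval `[0,T)`. -/
def CEIOn (R fmax T : ℝ) (f q ρ0 : ℝ → ℝ) (ρ : ℝ → ℝ → ℝ) (γm γp : ℝ → ℝ) : Prop :=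
  RegSol R ρ ∧ (∀ t, q t ∈ Icc (0:ℝ) fmax) ∧ EntIneqOn R fmax T f q ρ0 ρ ∧
    LeftTraceAt ρ γm ∧ RightTraceAt ρ γp ∧
    (∀ᵐ t ∂(volume.restrict (Ioo (0:ℝ) T)), f (γm t) ≤ q t ∧ f (γp t) ≤ q t)

/-- The weighted average `ξ(t) = ∫_{ℝ₋} w x * ρ t x dx`. -/
def wAvg (w : ℝ → ℝ) (ρ : ℝ → ℝ → ℝ) (t : ℝ) : ℝ := ∫ x in Iic (0:ℝ), w x * ρ t x

/-- Entropy weak solution of the Cauchy problem with non-local point constraint given by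
the (possibly multivalued, filled-in) piecewise constant `p`: there is a constraint level
`q` with `q t ∈ P(ξ(t)) = [p(ξ(t)+), p(ξ(t)−)]` a.e. such that `ρ` satisfies the
constrained entropy inequalities with constraint level `q`. -/
def EWSol (R fmax : ℝ) (f w p ρ0 : ℝ → ℝ) (ρ : ℝ → ℝ → ℝ) (γm γp : ℝ → ℝ) : Prop :=
  ∃ q : ℝ → ℝ, CEI R fmax f q ρ0 ρ γm γp ∧
    ∀ᵐ t ∂(volume.restrict (Ioi (0:ℝ))),
      q t ∈ Icc (pplus R p (wAvg w ρ t)) (pminus p (wAvg w ρ t))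

/-- Entropy weak solution with non-local constraint on the time interval `[0,T)`. -/
def EWSolOn (R fmax T : ℝ) (f w p ρ0 : ℝ → ℝ) (ρ : ℝ → ℝ → ℝ) (γm γp : ℝ → ℝ) : Prop :=
  ∃ q : ℝ → ℝ, CEIOn R fmax T f q ρ0 ρ γm γp ∧
    ∀ᵐ t ∂(volume.restrict (Ioo (0:ℝ) T)),
      q t ∈ Icc (pplus R p (wAvg w ρ t)) (pminus p (wAvg w ρ t))

/-- The Riemann initial datum. -/
def riem (ρL ρR : ℝ) (x : ℝ) : ℝ := if x < 0 then ρL else ρR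

/-- `ρ1 = ρ2` a.e. on `(0,T) × ℝ`. -/
def aeEqOn (T : ℝ) (ρ1 ρ2 : ℝ → ℝ → ℝ) : Prop :=
  ∀ᵐ z ∂((volume : Measure (ℝ × ℝ)).restrict (Ioo (0:ℝ) T ×ˢ (univ : Set ℝ))),
    ρ1 z.1 z.2 = ρ2 z.1 z.2

lemma TestFn.cont {φ : ℝ × ℝ → ℝ} (h : TestFn φ) : Continuous φ := h.1.continuous

lemma TestFn.diff {φ : ℝ × ℝ → ℝ} (h : TestFn φ) : Differentiable ℝ φ :=
  h.1.differentiable (by simp)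

lemma TestFn.cont_dir {φ : ℝ × ℝ → ℝ} (h : TestFn φ) (v : ℝ × ℝ) :
    Continuous (fun z => fderiv ℝ φ z v) :=
  (h.1.continuous_fderiv (by simp)).clm_apply continuous_const

lemma TestFn.cs_dir {φ : ℝ × ℝ → ℝ} (h : TestFn φ) (v : ℝ × ℝ) :
    HasCompactSupport (fun z => fderiv ℝ φ z v) :=
  HasCompactSupport.fderiv_apply (𝕜 := ℝ) h.2 v

lemma comp_cs {α : Type*} [TopologicalSpace α] [R1Space α] {g : ℝ × ℝ → ℝ}
    (hg : HasCompactSupport g) (γ : α → ℝ × ℝ)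
    (π : ℝ × ℝ → α) (hπ : Continuous π) (h : ∀ x, π (γ x) = x) :
    HasCompactSupport (fun x => g (γ x)) := by
  refine HasCompactSupport.intro (hg.isCompact.image hπ) ?_
  intro x hx
  by_contra hne
  exact hx ⟨γ x, subset_tsupport g hne, h x⟩

lemma int_curve {g : ℝ × ℝ → ℝ} (hc : Continuous g) (hg : HasCompactSupport g) (s : ℝ) :
    Integrable (fun t : ℝ => g (t, s * t)) :=
  Continuous.integrable_of_hasCompactSupport (by fun_prop)
    (comp_cs hg (fun t => (t, s * t)) Prod.fst continuous_fst (fun _ => rfl))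

lemma int_slice {g : ℝ × ℝ → ℝ} (hc : Continuous g) (hg : HasCompactSupport g) (t : ℝ) :
    Integrable (fun x : ℝ => g (t, x)) :=
  Continuous.integrable_of_hasCompactSupport (by fun_prop)
    (comp_cs hg (fun x => (t, x)) Prod.snd continuous_snd (fun _ => rfl))

lemma TestFn.pdX_eq {φ : ℝ × ℝ → ℝ} (h : TestFn φ) (t x : ℝ) :
    HasDerivAt (fun y => φ (t, y)) (pdX φ (t, x)) x := by
  have h1 : HasDerivAt (fun y : ℝ => ((t, y) : ℝ × ℝ)) (0, 1) x :=
    (hasDerivAt_const x t).prodMk (hasDerivAt_id x)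
  exact (h.diff (t, x)).hasFDerivAt.comp_hasDerivAt x h1

lemma TestFn.pdT_eq {φ : ℝ × ℝ → ℝ} (h : TestFn φ) (t x : ℝ) :
    HasDerivAt (fun s => φ (s, x)) (pdT φ (t, x)) t := by
  have h1 : HasDerivAt (fun s : ℝ => ((s, x) : ℝ × ℝ)) (1, 0) t :=
    (hasDerivAt_id t).prodMk (hasDerivAt_const t x)
  exact (h.diff (t, x)).hasFDerivAt.comp_hasDerivAt t h1

lemma TestFn.int_pdX {φ : ℝ × ℝ → ℝ} (h : TestFn φ) (t a : ℝ) :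
    ∫ x in Iio a, pdX φ (t, x) = φ (t, a) := by
  have h2 : HasCompactSupport (fun x => φ (t, x)) :=
    comp_cs h.2 (fun x => (t, x)) Prod.snd continuous_snd (fun _ => rfl)
  have h3 := h2.integral_Iic_deriv_eq
    ((h.1.of_le (by simp)).comp (contDiff_const.prodMk contDiff_id)) a
  rw [← integral_Iic_eq_integral_Iio]
  refine Eq.trans ?_ h3
  congr 1
  ext x
  exact (h.pdX_eq t x).deriv.symm

lemma TestFn.int_pdX_univ {φ : ℝ × ℝ → ℝ} (h : TestFn φ) (t : ℝ) :
    ∫ x, pdX φ (t, x) = 0 :=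
  integral_eq_zero_of_hasDerivAt_of_integrable (h.pdX_eq t)
    (int_slice (h.cont_dir (0, 1)) (h.cs_dir (0, 1)) t) (int_slice h.cont h.2 t)

lemma int_prod {g : ℝ × ℝ → ℝ} (hc : Continuous g) (hg : HasCompactSupport g) (S T : Set ℝ) :
    Integrable g ((volume.restrict S).prod (volume.restrict T)) := by
  rw [Measure.prod_restrict]
  exact (hc.integrable_of_hasCompactSupport hg).integrableOn

lemma TestFn.integrable_B {φ : ℝ × ℝ → ℝ} (h : TestFn φ) (S : Set ℝ) :
    Integrable (fun t => ∫ x in S, pdT φ (t, x)) (volume.restrict (Ioi (0:ℝ))) :=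
  (int_prod (h.cont_dir (1, 0)) (h.cs_dir (1, 0)) (Ioi 0) S).integral_prod_left

lemma TestFn.int_pdT {φ : ℝ × ℝ → ℝ} (h : TestFn φ) (S : Set ℝ) :
    ∫ t in Ioi (0:ℝ), ∫ x in S, pdT φ (t, x) = - ∫ x in S, φ (0, x) := by
  rw [integral_integral_swap (f := fun t x => pdT φ (t, x))
    (int_prod (h.cont_dir (1, 0)) (h.cs_dir (1, 0)) (Ioi 0) S), ← integral_neg]
  congr 1
  ext x
  have h2 : HasCompactSupport (fun t => φ (t, x)) :=
    comp_cs h.2 (fun t => (t, x)) Prod.fst continuous_fst (fun _ => rfl)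
  have h3 := h2.integral_Ioi_deriv_eq
    ((h.1.of_le (by simp)).comp (contDiff_id.prodMk contDiff_const)) 0
  refine Eq.trans ?_ h3
  congr 1
  ext t
  exact (h.pdT_eq t x).deriv.symm

/-- sheared test function -/
def sh (s : ℝ) (φ : ℝ × ℝ → ℝ) (z : ℝ × ℝ) : ℝ := φ (z.1, z.2 + s * z.1)

lemma TestFn.sh {φ : ℝ × ℝ → ℝ} (h : TestFn φ) (s : ℝ) : TestFn (sh s φ) := by
  refine ⟨h.1.comp (contDiff_fst.prodMk (contDiff_snd.add (contDiff_const.mul contDiff_fst))), ?_⟩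
  refine comp_cs h.2 (fun z : ℝ × ℝ => (z.1, z.2 + s * z.1)) (fun z => (z.1, z.2 - s * z.1))
    (by fun_prop) ?_
  intro z
  ext <;> simp

lemma TestFn.pdT_sh {φ : ℝ × ℝ → ℝ} (h : TestFn φ) (s t y : ℝ) :
    pdT φ (t, y + s * t) = pdT (CRP.sh s φ) (t, y) - s * pdX φ (t, y + s * t) := by
  have h1 : HasDerivAt (fun r : ℝ => ((r, y + s * r) : ℝ × ℝ)) (1, s) t := by
    have := (hasDerivAt_id t).prodMk (((hasDerivAt_id t).const_mul s).const_add y)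
    simpa using this
  have h2 := (h.diff (t, y + s * t)).hasFDerivAt.comp_hasDerivAt t h1
  have h3 := ((h.sh s).pdT_eq t y).unique h2
  have h4 : ((1, s) : ℝ × ℝ) = (1, 0) + s • (0, 1) := by simp
  rw [h3, h4, map_add, map_smul]
  simp [pdT, pdX]

lemma TestFn.int_A {φ : ℝ × ℝ → ℝ} (h : TestFn φ) (s t : ℝ) :
    ∫ x in Iio (s * t), pdT φ (t, x) =
      (∫ y in Iio (0:ℝ), pdT (CRP.sh s φ) (t, y)) - s * φ (t, s * t) := by
  have shift : ∀ g : ℝ → ℝ, ∫ x in Iio (s * t), g x = ∫ y in Iio (0:ℝ), g (y + s * t) := by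
    intro g
    have := (measurePreserving_add_right (volume : Measure ℝ) (s * t)).setIntegral_preimage_emb
      (MeasurableEquiv.addRight (s * t)).measurableEmbedding g (Iio (s * t))
    rw [← this]
    congr 2
    ext x
    simp
  have hX := h.int_pdX t (s * t)
  rw [shift] at hX
  rw [shift, ← hX, ← integral_const_mul, ← integral_sub]
  · congr 1
    ext y
    exact h.pdT_sh s t y
  · exact (int_slice ((h.sh s).cont_dir (1, 0)) ((h.sh s).cs_dir (1, 0)) t).integrableOn
  · exact (((int_slice (h.cont_dir (0, 1)) (h.cs_dir (0, 1)) t).comp_add_right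
      (s * t)).const_mul s).integrableOn

lemma integral_add4 {μ : Measure ℝ} {a b c d : ℝ → ℝ} (ha : Integrable a μ)
    (hb : Integrable b μ) (hc : Integrable c μ) (hd : Integrable d μ) :
    ∫ x, (a x + b x + c x + d x) ∂μ =
      (∫ x, a x ∂μ) + (∫ x, b x ∂μ) + (∫ x, c x ∂μ) + ∫ x, d x ∂μ := by
  have h1 : Integrable (fun x => a x + b x) μ := ha.add hb
  have h2 : Integrable (fun x => a x + b x + c x) μ := h1.add hc
  rw [integral_add h2 hd, integral_add h1 hc, integral_add ha hb]

/-- Entropy production of a piecewise constant function with three fronts. -/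
lemma TestFn.production {φ : ℝ × ℝ → ℝ} (h : TestFn φ) (s1 s2 s3 : ℝ) (h12 : s1 ≤ s2)
    (h23 : s2 ≤ s3) (E G : ℝ → ℝ → ℝ)
    (e1 e2 e3 e4 g1 g2 g3 g4 : ℝ)
    (hE : ∀ t x, 0 < t → E t x = if x < s1 * t then e1 else if x < s2 * t then e2
      else if x < s3 * t then e3 else e4)
    (hG : ∀ t x, 0 < t → G t x = if x < s1 * t then g1 else if x < s2 * t then g2
      else if x < s3 * t then g3 else g4) :
    ∫ t in Ioi (0:ℝ), ∫ x : ℝ, (E t x * pdT φ (t, x) + G t x * pdX φ (t, x)) =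
      - e4 * (∫ x, φ (0, x)) - (e1 - e4) * (∫ x in Iio (0:ℝ), φ (0, x))
      + ((g1 - g2) - s1 * (e1 - e2)) * (∫ t in Ioi (0:ℝ), φ (t, s1 * t))
      + ((g2 - g3) - s2 * (e2 - e3)) * (∫ t in Ioi (0:ℝ), φ (t, s2 * t))
      + ((g3 - g4) - s3 * (e3 - e4)) * (∫ t in Ioi (0:ℝ), φ (t, s3 * t)) := by
  have inner : ∀ t ∈ Ioi (0:ℝ), ∫ x : ℝ, (E t x * pdT φ (t, x) + G t x * pdX φ (t, x)) =
      e4 * (∫ x in univ, pdT φ (t, x))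
      + (e1 - e2) * (∫ y in Iio (0:ℝ), pdT (CRP.sh s1 φ) (t, y))
      + (e2 - e3) * (∫ y in Iio (0:ℝ), pdT (CRP.sh s2 φ) (t, y))
      + (e3 - e4) * (∫ y in Iio (0:ℝ), pdT (CRP.sh s3 φ) (t, y))
      + ((g1 - g2) - s1 * (e1 - e2)) * φ (t, s1 * t)
      + ((g2 - g3) - s2 * (e2 - e3)) * φ (t, s2 * t)
      + ((g3 - g4) - s3 * (e3 - e4)) * φ (t, s3 * t) := by
    intro t ht
    have ht' : (0:ℝ) < t := ht
    have o12 : s1 * t ≤ s2 * t := by gcongr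
    have o23 : s2 * t ≤ s3 * t := by gcongr
    have iT : Integrable (fun x => pdT φ (t, x)) :=
      int_slice (h.cont_dir (1, 0)) (h.cs_dir (1, 0)) t
    have iX : Integrable (fun x => pdX φ (t, x)) :=
      int_slice (h.cont_dir (0, 1)) (h.cs_dir (0, 1)) t
    have key : ∀ e g : ℝ, ∀ s : ℝ,
        Integrable (fun x => (Iio (s * t)).indicator
          (fun x => e * pdT φ (t, x) + g * pdX φ (t, x)) x) ∧
        ∫ x, (Iio (s * t)).indicator (fun x => e * pdT φ (t, x) + g * pdX φ (t, x)) x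
          = e * ((∫ y in Iio (0:ℝ), pdT (CRP.sh s φ) (t, y)) - s * φ (t, s * t))
            + g * φ (t, s * t) := by
      intro e g s
      refine ⟨((iT.const_mul e).add (iX.const_mul g)).indicator measurableSet_Iio, ?_⟩
      rw [integral_indicator measurableSet_Iio, integral_add (iT.const_mul e).integrableOn
        (iX.const_mul g).integrableOn, integral_const_mul, integral_const_mul]
      have hA := h.int_A s t
      have hX := h.int_pdX t (s * t)
      rw [hA, hX]
    have base : ∫ x, (e4 * pdT φ (t, x) + g4 * pdX φ (t, x)) =
        e4 * (∫ x in univ, pdT φ (t, x)) := by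
      rw [integral_add (iT.const_mul e4) (iX.const_mul g4), integral_const_mul,
        integral_const_mul]
      rw [h.int_pdX_univ t, setIntegral_univ]
      ring
    have dec : ∀ x, E t x * pdT φ (t, x) + G t x * pdX φ (t, x) =
        (((e4 * pdT φ (t, x) + g4 * pdX φ (t, x))
        + (Iio (s1 * t)).indicator
          (fun x => (e1 - e2) * pdT φ (t, x) + (g1 - g2) * pdX φ (t, x)) x)
        + (Iio (s2 * t)).indicator
          (fun x => (e2 - e3) * pdT φ (t, x) + (g2 - g3) * pdX φ (t, x)) x)
        + (Iio (s3 * t)).indicator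
          (fun x => (e3 - e4) * pdT φ (t, x) + (g3 - g4) * pdX φ (t, x)) x := by
      intro x
      rw [hE t x ht', hG t x ht']
      simp only [indicator, mem_Iio]
      by_cases c1 : x < s1 * t
      · have c2 : x < s2 * t := by linarith
        have c3 : x < s3 * t := by linarith
        simp only [c1, c2, c3, if_true]; ring
      · by_cases c2 : x < s2 * t
        · have c3 : x < s3 * t := by linarith
          simp only [c1, c2, c3, if_true, if_false]; ring
        · by_cases c3 : x < s3 * t
          · simp only [c1, c2, c3, if_true, if_false]; ring
          · simp only [c1, c2, c3, if_false]; ring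
    have i4 : Integrable (fun x => e4 * pdT φ (t, x) + g4 * pdX φ (t, x)) :=
      (iT.const_mul e4).add (iX.const_mul g4)
    have k1 := key (e1 - e2) (g1 - g2) s1
    have k2 := key (e2 - e3) (g2 - g3) s2
    have k3 := key (e3 - e4) (g3 - g4) s3
    rw [integral_congr_ae (Eventually.of_forall dec),
      integral_add4 i4 k1.1 k2.1 k3.1, k1.2, k2.2, k3.2, base]
    ring
  rw [setIntegral_congr_fun measurableSet_Ioi inner]
  have b0 := (h.integrable_B univ).const_mul e4
  have b1 := ((h.sh s1).integrable_B (Iio 0)).const_mul (e1 - e2)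
  have b2 := ((h.sh s2).integrable_B (Iio 0)).const_mul (e2 - e3)
  have b3 := ((h.sh s3).integrable_B (Iio 0)).const_mul (e3 - e4)
  have c1 := ((int_curve h.cont h.2 s1).restrict (s := Ioi 0)).const_mul
    ((g1 - g2) - s1 * (e1 - e2))
  have c2 := ((int_curve h.cont h.2 s2).restrict (s := Ioi 0)).const_mul
    ((g2 - g3) - s2 * (e2 - e3))
  have c3 := ((int_curve h.cont h.2 s3).restrict (s := Ioi 0)).const_mul
    ((g3 - g4) - s3 * (e3 - e4))
  refine (integral_add4 (((b0.add b1).add b2).add b3) c1 c2 c3).trans ?_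
  simp only [Pi.add_apply]
  rw [integral_add4 b0 b1 b2 b3]
  simp only [integral_const_mul]
  rw [h.int_pdT, (h.sh s1).int_pdT, (h.sh s2).int_pdT, (h.sh s3).int_pdT]
  simp only [CRP.sh, mul_zero, add_zero, setIntegral_univ]
  ring

/-- Entropy inequality across an increasing shock for a concave flux. -/
lemma shock_ineq {R : ℝ} {f : ℝ → ℝ} (hc : ConcaveOn ℝ (Icc 0 R) f) {a b k s : ℝ}
    (ha : a ∈ Icc 0 R) (hb : b ∈ Icc 0 R) (hab : a < b) (hs : s = (f b - f a) / (b - a)) :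
    0 ≤ (Real.sign (a - k) * (f a - f k) - Real.sign (b - k) * (f b - f k))
      - s * (|a - k| - |b - k|) := by
  have hba : 0 < b - a := by linarith
  have hs' : s * (b - a) = f b - f a := by rw [hs]; field_simp
  rcases lt_trichotomy k a with h | h | h
  · rw [Real.sign_of_pos (by linarith), Real.sign_of_pos (by linarith),
      abs_of_pos (by linarith), abs_of_pos (by linarith)]
    linarith
  · subst h
    rw [Real.sign_of_pos (by linarith : 0 < b - k), abs_of_pos (by linarith : 0 < b - k)]
    simp
    linarith
  rcases lt_trichotomy k b with h' | h' | h'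
  · rw [Real.sign_of_neg (by linarith), Real.sign_of_pos (by linarith),
      abs_of_neg (by linarith), abs_of_pos (by linarith)]
    have w1 : 0 ≤ (b - k) / (b - a) := div_nonneg (by linarith) hba.le
    have w2 : 0 ≤ (k - a) / (b - a) := div_nonneg (by linarith) hba.le
    have w3 : (b - k) / (b - a) + (k - a) / (b - a) = 1 := by field_simp; ring
    have h1 := hc.2 ha hb w1 w2 w3
    have e1 : ((b - k) / (b - a)) • a + ((k - a) / (b - a)) • b = k := by
      simp only [smul_eq_mul]; field_simp; ring
    have e2 : ((b - k) / (b - a)) • f a + ((k - a) / (b - a)) • f b = f a + s * (k - a) := by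
      rw [hs]; simp only [smul_eq_mul]; field_simp; ring
    rw [e1, e2] at h1
    linarith
  · subst h'
    rw [Real.sign_of_neg (by linarith : a - k < 0), abs_of_neg (by linarith : a - k < 0)]
    simp
    linarith
  · rw [Real.sign_of_neg (by linarith), Real.sign_of_neg (by linarith),
      abs_of_neg (by linarith), abs_of_neg (by linarith)]
    linarith

/-- Inequality across the stationary nonclassical shock. -/
lemma nc_ineq {f : ℝ → ℝ} {a b k m q : ℝ} (hab : b < a) (hfa : f a = q) (hfb : f b = q)
    (hq : 0 ≤ q) (hqm : q ≤ m) (hm : 0 < m) (hk0 : 0 ≤ f k) (hkm : f k ≤ m) :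
    0 ≤ (Real.sign (a - k) * (f a - f k) - Real.sign (b - k) * (f b - f k))
      + 2 * ((1 - q / m) * f k) := by
  have h1 : q / m ≤ 1 := (div_le_one hm).2 hqm
  have h2 : 0 ≤ (1 - q / m) * f k := mul_nonneg (by linarith) hk0
  rw [hfa, hfb]
  rcases lt_trichotomy k b with h | h | h
  · rw [Real.sign_of_pos (by linarith), Real.sign_of_pos (by linarith)]
    linarith
  · subst h
    rw [hfb] at h2 ⊢
    simpa using h2
  rcases lt_trichotomy k a with h' | h' | h'
  · rw [Real.sign_of_pos (by linarith), Real.sign_of_neg (by linarith)]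
    have h3 : f k / m ≤ 1 := (div_le_one hm).2 hkm
    have h4 : 0 ≤ q * (1 - f k / m) := mul_nonneg hq (by linarith)
    have h5 : q / m * f k = q * (f k / m) := by ring
    nlinarith
  · subst h'
    rw [hfa] at h2 ⊢
    simpa using h2
  · rw [Real.sign_of_neg (by linarith), Real.sign_of_neg (by linarith)]
    linarith

/-- A thin-wedge estimate giving traces. -/
lemma trace_lim {g : ℝ → ℝ → ℝ} {S : ℝ → Set ℝ} {φ : ℝ × ℝ → ℝ} (hφ : TestFn φ) (c M : ℝ)
    (hc : 0 < c) (hM : ∀ t x, |g t x| ≤ M) (hS : ∀ ε, 0 < ε → volume.real (S ε) = ε)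
    (hg : ∀ ε t x, 0 < ε → c * ε ≤ t → x ∈ S ε → g t x = 0) :
    Tendsto (fun ε : ℝ => (1 / ε) * ∫ t in Ioi (0:ℝ), ∫ x in S ε, |g t x| * φ (t, x))
      (nhdsWithin 0 (Ioi 0)) (nhds 0) := by
  obtain ⟨C, hC⟩ := hφ.cont.bounded_above_of_compact_support hφ.2
  have hC0 : 0 ≤ C := (norm_nonneg _).trans (hC 0)
  have hM0 : 0 ≤ M := (abs_nonneg _).trans (hM 0 0)
  have lim : Tendsto (fun ε : ℝ => M * C * c * ε) (nhdsWithin 0 (Ioi 0)) (nhds 0) := by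
    have : Tendsto (fun ε : ℝ => M * C * c * ε) (nhds 0) (nhds (M * C * c * 0)) :=
      (continuous_const.mul continuous_id).tendsto 0
    rw [mul_zero] at this
    exact this.mono_left nhdsWithin_le_nhds
  refine squeeze_zero_norm' ?_ lim
  filter_upwards [self_mem_nhdsWithin] with ε hε
  have hε' : (0:ℝ) < ε := hε
  have hfin : volume (S ε) < ⊤ := by
    by_contra hcon
    have h1 := hS ε hε'
    rw [Measure.real, top_le_iff.1 (not_lt.1 hcon)] at h1
    simp at h1
    linarith
  have inner : ∀ t ∈ Ioi (0:ℝ), ‖∫ x in S ε, |g t x| * φ (t, x)‖ ≤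
      (Ioo 0 (c * ε)).indicator (fun _ => M * C * ε) t := by
    intro t ht
    by_cases hlt : t < c * ε
    · rw [indicator_of_mem (show t ∈ Ioo 0 (c * ε) from ⟨ht, hlt⟩)]
      refine (norm_setIntegral_le_of_norm_le_const (C := M * C) hfin ?_).trans
        (by rw [hS ε hε'])
      intro x _
      rw [norm_mul, Real.norm_eq_abs, abs_abs]
      exact mul_le_mul (hM t x) (hC _) (norm_nonneg _) hM0
    · rw [indicator_of_notMem (fun h => hlt h.2)]
      rw [setIntegral_eq_zero_of_forall_eq_zero]
      · simp
      · intro x hx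
        rw [hg ε t x hε' (not_lt.1 hlt) hx]
        simp
  have outer : ‖∫ t in Ioi (0:ℝ), ∫ x in S ε, |g t x| * φ (t, x)‖ ≤ M * C * ε * (c * ε) := by
    have hint : Integrable ((Ioo 0 (c * ε)).indicator (fun _ : ℝ => M * C * ε))
        (volume.restrict (Ioi 0)) := by
      refine Integrable.restrict ?_
      exact (integrable_indicator_iff measurableSet_Ioo).2
        (integrableOn_const (by simp))
    refine (norm_integral_le_of_norm_le hint
      ((ae_restrict_iff' measurableSet_Ioi).2 (Eventually.of_forall inner))).trans ?_
    rw [setIntegral_indicator measurableSet_Ioo]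
    have : Ioi (0:ℝ) ∩ Ioo 0 (c * ε) = Ioo 0 (c * ε) := inter_eq_right.2 (fun x hx => hx.1)
    rw [this, setIntegral_const]
    have hcε : 0 ≤ c * ε := by positivity
    simp only [smul_eq_mul, Real.volume_real_Ioo_of_le hcε]
    apply le_of_eq
    ring
  rw [norm_mul]
  have : ‖1 / ε‖ = 1 / ε := by rw [Real.norm_eq_abs, abs_of_pos (by positivity)]
  rw [this]
  calc 1 / ε * _ ≤ 1 / ε * (M * C * ε * (c * ε)) := by gcongr
    _ = M * C * c * ε := by field_simp

/-- in the two-solver configuration with the non-local constraint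
`p = p1 · χ_{[0,ρL]} + p2 · χ_{(ρL,R]}`, the explicit profile `ρ_p` (shock `ρL → ρ̂2` of
speed `λ_p`, stationary nonclassical shock `ρ̂2 → ρ̌2`, shock `ρ̌2 → ρ̄` of speed `μ_p`)
is an entropy weak solution of the constrained Riemann problem with datum `(ρL, ρ̄)` and
constraint level `q ≡ p2`; moreover `∫ w ρ_p(t) > ρL` for all `t > 0` and the flux
through `x = 0` equals `p2`. -/
theorem stmt18 (R ρb p1 p2 ρL ρh2 ρc2 lp mp : ℝ) (f w p : ℝ → ℝ)
    (hR : 0 < R) (hf : ContDiffOn ℝ 1 f (Icc 0 R)) (hf0 : f 0 = 0) (hfR : f R = 0)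
    (hfpos : ∀ x ∈ Icc (0:ℝ) R, 0 ≤ f x)
    (hconc : StrictAntiOn (deriv f) (Icc 0 R))
    (hρb : ρb ∈ Ioo 0 R) (hmax : ∀ x ∈ Icc (0:ℝ) R, x ≠ ρb → f x < f ρb)
    (hp2 : 0 < p2) (hp12 : p2 < p1) (hp1 : p1 ≤ f ρb)
    (hρL : ρL ∈ Ioo ρb R) (hfL1 : p2 < f ρL) (hfL2 : f ρL < p1)
    (hρh2 : ρh2 ∈ Ioo ρL R) (hρc2 : ρc2 ∈ Ioo (0:ℝ) ρb)
    (hfh2 : f ρh2 = p2) (hfc2 : f ρc2 = p2)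
    (hlp : lp = (p2 - f ρL) / (ρh2 - ρL))
    (hmp : mp = (f ρb - p2) / (ρb - ρc2))
    (hW : AW w) (hp : ∀ ξ, p ξ = if ξ ≤ ρL then p1 else p2)
    (ρp : ℝ → ℝ → ℝ)
    (hρp : ∀ t x, ρp t x =
      if t ≤ 0 then riem ρL ρb x
      else if x < lp * t then ρL
      else if x < 0 then ρh2
      else if x < mp * t then ρc2
      else ρb) :
    (CEI R (f ρb) f (fun _ => p2) (riem ρL ρb) ρp (fun _ => ρh2) (fun _ => ρc2) ∧
      ∀ᵐ t ∂(volume.restrict (Ioi (0:ℝ))),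
        p2 ∈ Icc (pplus R p (wAvg w ρp t)) (pminus p (wAvg w ρp t))) ∧
    EWSol R (f ρb) f w p (riem ρL ρb) ρp (fun _ => ρh2) (fun _ => ρc2) ∧
    (∀ t, 0 < t → ρL < wAvg w ρp t) ∧
    f ρh2 = p2 ∧ f ρc2 = p2 := by
  obtain ⟨hb0, hbR⟩ := hρb
  obtain ⟨hbL, hLR⟩ := hρL
  obtain ⟨hLh, hhR⟩ := hρh2
  obtain ⟨hc0, hcb⟩ := hρc2
  have hlp0 : lp < 0 := by
    rw [hlp]; exact div_neg_of_neg_of_pos (by linarith) (by linarith)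
  have hmp0 : 0 < mp := by
    rw [hmp]; exact div_pos (by linarith) (by linarith)
  -- formula valid for all nonnegative times
  have form : ∀ t x, 0 ≤ t → ρp t x = if x < lp * t then ρL else if x < 0 then ρh2
      else if x < mp * t then ρc2 else ρb := by
    intro t x ht
    rw [hρp]
    rcases ht.eq_or_lt with h0 | h0
    · subst h0
      simp only [le_refl, if_true, mul_zero, riem]
      by_cases hx : x < 0 <;> simp [hx]
    · rw [if_neg (not_le.2 h0)]
  have range : ∀ t x, ρp t x ∈ Icc (0:ℝ) R := by
    intro t x
    rw [hρp]
    unfold riem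
    split_ifs <;> constructor <;> linarith
  have meas : Measurable (Function.uncurry ρp) := by
    have e : Function.uncurry ρp = fun z : ℝ × ℝ =>
        if z.1 ≤ 0 then (if z.2 < 0 then ρL else ρb)
        else if z.2 < lp * z.1 then ρL
        else if z.2 < 0 then ρh2
        else if z.2 < mp * z.1 then ρc2
        else ρb := by
      ext ⟨t, x⟩
      exact hρp t x
    rw [e]
    refine Measurable.ite (measurableSet_le measurable_fst measurable_const)
      (Measurable.ite (measurableSet_lt measurable_snd measurable_const)
        measurable_const measurable_const) ?_
    refine Measurable.ite (measurableSet_lt measurable_snd (measurable_fst.const_mul lp))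
      measurable_const ?_
    refine Measurable.ite (measurableSet_lt measurable_snd measurable_const)
      measurable_const ?_
    exact Measurable.ite (measurableSet_lt measurable_snd (measurable_fst.const_mul mp))
      measurable_const measurable_const
  have measx : ∀ t, Measurable (ρp t) := fun t => meas.comp measurable_prodMk_left
  have reg : RegSol R ρp := by
    refine ⟨meas, range, ?_⟩
    intro r _ s hs
    have key := tendsto_integral_filter_of_dominated_convergence
      (μ := volume.restrict (Icc (-r) r)) (l := nhdsWithin s (Ici 0))
      (F := fun t x => |ρp t x - ρp s x|) (f := fun _ => (0:ℝ)) (fun _ => R)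
      (Eventually.of_forall fun t =>
        (continuous_abs.measurable.comp ((measx t).sub (measx s))).aestronglyMeasurable)
      (Eventually.of_forall fun t => Eventually.of_forall fun x => by
        have h1 := range t x
        have h2 := range s x
        rw [Real.norm_eq_abs, abs_abs, abs_le]
        constructor <;> linarith [h1.1, h1.2, h2.1, h2.2])
      (integrableOn_const (by simp))
      (by
        have hne : ∀ a : ℝ, ∀ᵐ x ∂(volume.restrict (Icc (-r) r)), x ≠ a := fun a =>
          ae_restrict_of_ae (by simp [ae_iff, measure_singleton])
        filter_upwards [hne (lp * s), hne (mp * s)] with x hx1 hx2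
        have ev : ∀ c : ℝ, x ≠ c * s →
            ∀ᶠ t in nhdsWithin s (Ici 0), (x < c * t ↔ x < c * s) := by
          intro c hc
          have ct : Tendsto (fun t : ℝ => c * t) (nhdsWithin s (Ici 0)) (nhds (c * s)) :=
            ((continuous_const.mul continuous_id).tendsto s).mono_left nhdsWithin_le_nhds
          rcases lt_or_gt_of_ne hc with h | h
          · filter_upwards [ct.eventually (lt_mem_nhds h)] with t ht
            exact ⟨fun _ => h, fun _ => ht⟩
          · filter_upwards [ct.eventually (gt_mem_nhds h)] with t ht
            exact ⟨fun h' => absurd h' (not_lt.2 ht.le), fun h' => absurd h' (not_lt.2 h.le)⟩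
        refine Tendsto.congr' ?_ tendsto_const_nhds
        filter_upwards [ev lp hx1, ev mp hx2, self_mem_nhdsWithin] with t h1 h2 h3
        rw [form t x h3, form s x hs]
        simp only [h1, h2, sub_self, abs_zero])
    simpa using key
  have hconcave : ConcaveOn ℝ (Icc 0 R) f :=
    (StrictAntiOn.strictConcaveOn_of_deriv (convex_Icc 0 R) hf.continuousOn
      (hconc.mono interior_subset)).concaveOn
  have ent : EntIneq R (f ρb) f (fun _ => p2) (riem ρL ρb) ρp := by
    intro φ hφ hpos k hk
    have hkm : f k ≤ f ρb := by
      by_cases h : k = ρb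
      · rw [h]
      · exact (hmax k hk h).le
    have hprod := hφ.production lp 0 mp hlp0.le hmp0.le
      (fun t x => |ρp t x - k|) (fun t x => Real.sign (ρp t x - k) * (f (ρp t x) - f k))
      (|ρL - k|) (|ρh2 - k|) (|ρc2 - k|) (|ρb - k|)
      (Real.sign (ρL - k) * (f ρL - f k)) (Real.sign (ρh2 - k) * (f ρh2 - f k))
      (Real.sign (ρc2 - k) * (f ρc2 - f k)) (Real.sign (ρb - k) * (f ρb - f k))
      (by
        intro t x ht
        simp only [form t x ht.le, zero_mul]
        split_ifs <;> rfl)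
      (by
        intro t x ht
        simp only [form t x ht.le, zero_mul]
        split_ifs <;> rfl)
    have hinit : ∫ x : ℝ, |riem ρL ρb x - k| * φ (0, x) =
        |ρb - k| * (∫ x, φ (0, x)) + (|ρL - k| - |ρb - k|) * ∫ x in Iio (0:ℝ), φ (0, x) := by
      have i0 := int_slice hφ.cont hφ.2 0
      rw [← integral_const_mul, ← integral_const_mul, ← integral_indicator measurableSet_Iio,
        ← integral_add (i0.const_mul _) ((i0.const_mul _).indicator measurableSet_Iio)]
      congr 1
      ext x
      by_cases hx : x < 0
      · simp only [riem, hx, if_true, indicator, mem_Iio]; ring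
      · simp only [riem, hx, if_false, indicator, mem_Iio]; ring
    have j : ∀ s : ℝ, 0 ≤ ∫ t in Ioi (0:ℝ), φ (t, s * t) := fun s =>
      integral_nonneg fun t => hpos _
    have q1 := shock_ineq (k := k) hconcave (a := ρL) (b := ρh2) (s := lp)
      ⟨by linarith, by linarith⟩ ⟨by linarith, by linarith⟩ hLh (by rw [hlp, hfh2])
    have q3 := shock_ineq (k := k) hconcave (a := ρc2) (b := ρb) (s := mp)
      ⟨by linarith, by linarith⟩ ⟨by linarith, by linarith⟩ hcb (by rw [hmp, hfc2])
    have q2 := nc_ineq (k := k) (f := f) (a := ρh2) (b := ρc2) (m := f ρb) (q := p2)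
      (by linarith) hfh2 hfc2 hp2.le (by linarith) (by linarith) (hfpos k hk) hkm
    have z1 := mul_nonneg q1 (j lp)
    have z3 := mul_nonneg q3 (j mp)
    have z2 := mul_nonneg q2 (j 0)
    rw [hprod, hinit, integral_const_mul]
    simp only [zero_mul] at z2 ⊢
    linarith
  have ltr : LeftTraceAt ρp (fun _ => ρh2) := by
    intro φ hφ
    refine trace_lim (g := fun t x => ρp t x - ρh2) (S := fun ε => Ioo (-ε) 0) hφ
      (-1 / lp) R (div_pos_of_neg_of_neg (by norm_num) hlp0) ?_ ?_ ?_
    · intro t x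
      have := range t x
      rw [abs_le]
      constructor <;> linarith [this.1, this.2]
    · intro ε hε
      rw [Real.volume_real_Ioo_of_le (by linarith)]
      ring
    · intro ε t x hε ht hx
      have hneg : 0 < -1 / lp := div_pos_of_neg_of_neg (by norm_num) hlp0
      have ht0 : 0 ≤ t := le_trans (by positivity) ht
      have hle : lp * t ≤ -ε := by
        have h1 := mul_le_mul_of_nonpos_left ht hlp0.le
        have h2 : lp * (-1 / lp * ε) = -ε := by
          have hne : lp ≠ 0 := hlp0.ne
          field_simp
        linarith
      have hx' : ¬ x < lp * t := by have := hx.1; linarith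
      simp only [form t x ht0, hx', hx.2, if_true, if_false, sub_self]
  have rtr : RightTraceAt ρp (fun _ => ρc2) := by
    intro φ hφ
    refine trace_lim (g := fun t x => ρp t x - ρc2) (S := fun ε => Ioo 0 ε) hφ
      (1 / mp) R (by positivity) ?_ ?_ ?_
    · intro t x
      have := range t x
      rw [abs_le]
      constructor <;> linarith [this.1, this.2]
    · intro ε hε
      rw [Real.volume_real_Ioo_of_le (by linarith)]
      ring
    · intro ε t x hε ht hx
      have ht0 : 0 ≤ t := le_trans (by positivity) ht
      have hle : ε ≤ mp * t := by
        have h1 := mul_le_mul_of_nonneg_left ht hmp0.le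
        have h2 : mp * (1 / mp * ε) = ε := by field_simp
        linarith
      have hx1 : ¬ x < 0 := not_lt.2 hx.1.le
      have hx2 : x < mp * t := hx.2.trans_le hle
      have hx3 : ¬ x < lp * t := by
        have := mul_nonpos_of_nonpos_of_nonneg hlp0.le ht0
        have := hx.1
        linarith
      simp only [form t x ht0, hx1, hx2, hx3, if_true, if_false, sub_self]
  have cei : CEI R (f ρb) f (fun _ => p2) (riem ρL ρb) ρp (fun _ => ρh2) (fun _ => ρc2) :=
    ⟨reg, fun _ => ⟨hp2.le, by linarith⟩, ent, ltr, rtr,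
      Eventually.of_forall fun _ => ⟨hfh2.le, hfc2.le⟩⟩
  have avg : ∀ t, 0 < t → ρL < wAvg w ρp t := by
    intro t ht
    obtain ⟨hw0, hwm, hw1, -⟩ := hW
    have hlt : lp * t < 0 := mul_neg_of_neg_of_pos hlp0 ht
    have iw : IntegrableOn w (Iic 0) := by
      by_contra hcon
      rw [integral_undef hcon] at hw1
      norm_num at hw1
    have iwρ : IntegrableOn (fun x => w x * ρp t x) (Iic 0) := by
      refine Integrable.mul_bdd (c := R) iw (measx t).aestronglyMeasurable ?_
      refine Eventually.of_forall fun x => ?_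
      rw [Real.norm_eq_abs, abs_of_nonneg (range t x).1]
      exact (range t x).2
    have id : IntegrableOn (fun x => w x * ρp t x - w x * ρL) (Iic 0) :=
      iwρ.sub (iw.mul_const ρL)
    have e1 : ∫ x in Iic (0:ℝ), (w x * ρp t x - w x * ρL) = wAvg w ρp t - ρL := by
      rw [integral_sub iwρ (iw.mul_const ρL), integral_mul_const, hw1, one_mul]
      rfl
    have val : ∀ x, x < 0 → ρp t x = if x < lp * t then ρL else ρh2 := by
      intro x hx
      rw [form t x ht.le]
      simp only [hx, if_true]
    have hnn : 0 ≤ᵐ[volume.restrict (Iic (0:ℝ))] fun x => w x * ρp t x - w x * ρL := by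
      rw [← restrict_Iio_eq_restrict_Iic]
      refine (ae_restrict_iff' measurableSet_Iio).2 (Eventually.of_forall fun x hx => ?_)
      have hx' : x < 0 := hx
      simp only [Pi.zero_apply, val x hx', ← mul_sub]
      refine mul_nonneg (hw0 x hx'.le) ?_
      split_ifs <;> linarith
    have hge : 0 ≤ wAvg w ρp t - ρL := e1 ▸ integral_nonneg_of_ae hnn
    rcases hge.eq_or_lt with h0 | h0
    swap
    · linarith
    exfalso
    rw [← e1] at h0
    have hz := (setIntegral_eq_zero_iff_of_nonneg_ae hnn id).1 h0.symm
    have hz' : ∀ᵐ x, x ∈ Iic (0:ℝ) → w x * ρp t x - w x * ρL = 0 :=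
      (ae_restrict_iff' measurableSet_Iic).1 hz
    have wz : ∀ x, x < 0 → w x = 0 := by
      intro x hx
      have hlt' : max x (lp * t) < 0 := max_lt hx hlt
      have hfreq : ∃ y ∈ Ioo (max x (lp * t)) 0, y ∈ Iic (0:ℝ) →
          w y * ρp t y - w y * ρL = 0 := by
        by_contra hcon
        push Not at hcon
        have hsub : Ioo (max x (lp * t)) 0 ⊆
            {y | ¬ (y ∈ Iic (0:ℝ) → w y * ρp t y - w y * ρL = 0)} := by
          intro y hy hh
          exact (hcon y hy).2 (hh (hcon y hy).1)
        have h0 := measure_mono_null hsub (ae_iff.1 hz')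
        rw [Real.volume_Ioo] at h0
        have := ENNReal.ofReal_eq_zero.1 h0
        linarith
      obtain ⟨y, hy, hyz⟩ := hfreq
      have hy0 : y < 0 := hy.2
      have hyx : x < y := (le_max_left _ _).trans_lt hy.1
      have hyl : lp * t < y := (le_max_right _ _).trans_lt hy.1
      have h1 := hyz hy0.le
      rw [val y hy0, if_neg (not_lt.2 hyl.le), ← mul_sub] at h1
      have h2 : w y = 0 := by
        rcases mul_eq_zero.1 h1 with h | h
        · exact h
        · linarith
      have h3 := hwm hx.le hy0.le hyx.le
      have h4 := hw0 x hx.le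
      linarith
    have : ∫ x in Iic (0:ℝ), w x = 0 := by
      rw [integral_Iic_eq_integral_Iio]
      exact setIntegral_eq_zero_of_forall_eq_zero wz
    linarith
  have con : ∀ᵐ t ∂(volume.restrict (Ioi (0:ℝ))),
      p2 ∈ Icc (pplus R p (wAvg w ρp t)) (pminus p (wAvg w ρp t)) := by
    refine (ae_restrict_iff' measurableSet_Ioi).2 (Eventually.of_forall fun t ht => ?_)
    have hξ := avg t ht
    constructor
    · unfold pplus
      split_ifs with h
      · rw [hp, if_neg (by linarith)]
      · refine csSup_le ⟨p R, R, ⟨not_le.1 h, le_refl R⟩, rfl⟩ ?_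
        rintro _ ⟨y, hy, rfl⟩
        rw [hp, if_neg (by have := hy.1; linarith)]
    · unfold pminus
      rw [if_neg (by linarith)]
      refine le_csInf ⟨p 0, 0, ⟨le_refl 0, by linarith⟩, rfl⟩ ?_
      rintro _ ⟨y, hy, rfl⟩
      rw [hp]
      split_ifs <;> linarith
  exact ⟨⟨cei, con⟩, ⟨_, cei, con⟩, avg, hfh2, hfc2⟩

end

end CRP
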